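/- Let B be a finite skew brace whose order is a power of a prime p, and suppose b∗b = 0 for all b ∈ B. Then B is centrally nilpotent. -/

import Mathlib

/-- A (left) skew brace: a set with two group structures `(B,+)` and `(B,·)`
satisfying `a · (b + c) = a · b - a + a · c`. -/
class SkewBrace (B : Type*) extends AddGroup B, Group B where
  skew : ∀ a b c : B, a * (b + c) = a * b - a + a * c

/-- The star product of a skew brace: `a ∗ b = -a + a·b - b`. -/
def sstar {B : Type*} [SkewBrace B] (a b : B) : B := -a + a * b - b

/-- The upper central series of a skew brace, defined elementwise:
`zeta B 0 = {0}` and `x ∈ zeta B (n+1)` iff the image of `x` in the quotient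
`B / zeta B n` lies in `ζ(B/zeta B n) = Soc(B/zeta B n) ∩ Z(B/zeta B n, ·)`,
i.e. iff for all `b`, `x·b ≡ x + b` (so `x` is in the kernel of the `λ`-map of
the quotient), `x + b ≡ b + x` and `x·b ≡ b·x` modulo `zeta B n`. -/
def zeta (B : Type*) [SkewBrace B] : ℕ → Set B
  | 0 => {0}
  | n + 1 =>
    {x | ∀ b : B,
      -(x * b) + (x + b) ∈ zeta B n ∧
      -(x + b) + (b + x) ∈ zeta B n ∧
      (x * b)⁻¹ * (b * x) ∈ zeta B n}

/-- A skew brace is centrally nilpotent if its upper central series reaches `B`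
after finitely many steps. -/
def CentrallyNilpotent (B : Type*) [SkewBrace B] : Prop :=
  ∃ n : ℕ, zeta B n = Set.univ

namespace SkewBrace

section Basic

variable {B : Type*} [SkewBrace B]

theorem mul_zero' (a : B) : a * 0 = a := by
  have h := skew a 0 0
  rw [add_zero] at h
  exact sub_eq_zero.mp (add_eq_right.mp h.symm)

theorem one_eq_zero : (1 : B) = 0 := by
  simpa using (mul_zero' (1 : B)).symm

/-- The map `λ_a(b) = -a + a·b`. -/
def lam (a b : B) : B := -a + a * b

theorem lam_add (a b c : B) : lam a (b + c) = lam a b + lam a c := by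
  simp only [lam, skew, sub_eq_add_neg, add_assoc]

theorem mul_eq_add_lam (a b : B) : a * b = a + lam a b := by
  simp [lam]

theorem lam_zero (a : B) : lam a 0 = 0 := by
  simp [lam, mul_zero']

theorem lam_neg (a b : B) : lam a (-b) = -lam a b := by
  rw [eq_neg_iff_add_eq_zero, ← lam_add, neg_add_cancel, lam_zero]

theorem lam_one (b : B) : lam 1 b = b := by
  simp [lam, one_eq_zero (B := B) ▸ one_mul b, one_eq_zero (B := B)]

theorem lam_mul (a b c : B) : lam (a * b) c = lam a (lam b c) := by
  have h : lam a (lam b c) = -lam a b + lam a (b * c) := by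
    rw [← lam_neg, ← lam_add]; rfl
  rw [h]
  simp [lam, neg_add_rev, mul_assoc, add_assoc]

/-- If `b ∗ b = 0` for all `b`, then `a ∗ b = 0` implies `b ∗ a = 0`. -/
theorem mul_eq_add_symm (hsq : ∀ b : B, b * b = b + b) {a b : B} (hab : a * b = a + b) :
    b * a = b + a := by
  have h₁ : a * (b * (a + b)) = a * (b * a) + b := by
    rw [skew b, hsq b, ← add_assoc, sub_add_cancel, skew a, hab, ← add_assoc, sub_add_cancel]
  have h₂ : a * (b * (a + b)) = a + b + a + b := by
    rw [← mul_assoc, ← hab, hsq, hab]; simp only [add_assoc]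
  have h₃ : a * (b * a) = a + b + a := add_right_cancel (h₁.symm.trans h₂)
  have h₄ : a * (b + a) = a + b + a := by
    rw [skew, hab, hsq]; simp [sub_eq_add_neg, add_assoc]
  exact mul_left_cancel (h₃.trans h₄.symm)

/-- Membership in `ζ(B) = Soc(B) ∩ Z(B,·)`. -/
def IsCentral (z : B) : Prop := ∀ b : B, z * b = z + b ∧ z + b = b + z ∧ z * b = b * z

theorem mem_zeta_one_iff {z : B} : z ∈ zeta B 1 ↔ IsCentral z := by
  refine forall_congr' fun b => ?_
  have h : (z * b)⁻¹ * (b * z) = 0 ↔ z * b = b * z := by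
    rw [← one_eq_zero, inv_mul_eq_one]
  simp only [zeta, Set.mem_singleton_iff, neg_add_eq_zero, h]

namespace IsCentral

theorem zero : IsCentral (0 : B) := fun b => by
  simp [mul_zero', one_eq_zero (B := B) ▸ one_mul b]

theorem add {z w : B} (hz : IsCentral z) (hw : IsCentral w) : IsCentral (z + w) := fun b => by
  refine ⟨?_, ?_, ?_⟩
  · rw [← (hz w).1, mul_assoc, (hw b).1, (hz _).1, (hz w).1, add_assoc]
  · rw [add_assoc, (hw b).2.1, ← add_assoc, (hz b).2.1, add_assoc]
  · rw [← (hz w).1, mul_assoc, (hw b).2.2, ← mul_assoc, (hz b).2.2, mul_assoc]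

theorem neg {z : B} (hz : IsCentral z) : IsCentral (-z) := fun b => by
  have h : z⁻¹ = -z := by
    have := (hz z⁻¹).1
    rw [mul_inv_cancel, one_eq_zero] at this
    exact (neg_eq_of_add_eq_zero_right this.symm).symm
  refine ⟨?_, ?_, ?_⟩
  · have := (hz (z⁻¹ * b)).1
    rw [mul_inv_cancel_left] at this
    rw [← h, eq_comm, h, neg_add_eq_iff_eq_add, ← h]
    exact this
  · exact ((AddCommute.neg_left (a := z) (b := b) (hz b).2.1)).eq
  · rw [← h]
    exact (Commute.inv_left (a := z) (b := b) (hz b).2.2).eq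

theorem add_add_add {z w : B} (hw : IsCentral w) (a b : B) :
    z + a + (w + b) = z + w + (a + b) := by
  rw [add_assoc, ← add_assoc a, ← (hw a).2.1]; simp only [add_assoc]

theorem add_mul_add {z w : B} (hz : IsCentral z) (hw : IsCentral w) (a b : B) :
    (z + a) * (w + b) = z + w + a * b := by
  rw [← (hz a).1, ← (hw b).1, ← ((hz.add hw) _).1, ← (hz w).1, mul_assoc, ← mul_assoc a,
    ← (hw a).2.2]
  simp only [mul_assoc]

end IsCentral

variable (B) in
/-- Congruence modulo `ζ(B)`. -/
def centralSetoid : Setoid B where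
  r a b := ∃ z, IsCentral z ∧ b = z + a
  iseqv :=
    { refl a := ⟨0, .zero, (zero_add a).symm⟩
      symm := by
        rintro a _ ⟨z, hz, rfl⟩
        exact ⟨-z, hz.neg, (neg_add_cancel_left z a).symm⟩
      trans := by
        rintro a _ _ ⟨z, hz, rfl⟩ ⟨w, hw, rfl⟩
        exact ⟨w + z, hw.add hz, (add_assoc w z a).symm⟩ }

variable (B) in
/-- `centralSetoid` as an additive congruence. -/
def centralAddCon : AddCon B where
  toSetoid := centralSetoid B
  add' := by
    rintro a _ b _ ⟨z, hz, rfl⟩ ⟨w, hw, rfl⟩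
    exact ⟨z + w, hz.add hw, hw.add_add_add a b⟩

variable (B) in
/-- `centralSetoid` as a multiplicative congruence. -/
def centralCon : Con B where
  toSetoid := centralSetoid B
  mul' := by
    rintro a _ b _ ⟨z, hz, rfl⟩ ⟨w, hw, rfl⟩
    exact ⟨z + w, hz.add hw, hz.add_mul_add hw a b⟩

variable (B) in
/-- The quotient `B / ζ(B)`. -/
def CentralQuotient : Type _ := Quotient (centralSetoid B)

/-- The quotient map `B → B / ζ(B)`. -/
def CentralQuotient.mk (b : B) : CentralQuotient B := Quotient.mk (centralSetoid B) b

theorem CentralQuotient.mk_surjective : Function.Surjective (mk (B := B)) :=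
  Quotient.mk_surjective

instance : SkewBrace (CentralQuotient B) where
  __ := (inferInstance : AddGroup (centralAddCon B).Quotient)
  __ := (inferInstance : Group (centralCon B).Quotient)
  skew a b c := by
    induction a using Quotient.inductionOn
    induction b using Quotient.inductionOn
    induction c using Quotient.inductionOn
    exact congrArg CentralQuotient.mk (skew _ _ _)

theorem CentralQuotient.mk_eq_zero_iff {x : B} : mk x = 0 ↔ IsCentral x := by
  have h : mk x = 0 ↔ ∃ z, IsCentral z ∧ (0 : B) = z + x :=
    Quotient.eq (r := centralSetoid B) (x := x) (y := 0)
  rw [h]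
  constructor
  · rintro ⟨z, hz, h⟩
    rw [← neg_eq_of_add_eq_zero_right h.symm]
    exact hz.neg
  · exact fun hx => ⟨-x, hx.neg, (neg_add_cancel x).symm⟩

theorem CentralQuotient.mk_mem_zeta_iff (n : ℕ) :
    ∀ x : B, mk x ∈ zeta (CentralQuotient B) n ↔ x ∈ zeta B (n + 1) := by
  induction n with
  | zero => exact fun x => mk_eq_zero_iff.trans mem_zeta_one_iff.symm
  | succ n ih =>
    intro x
    refine (mk_surjective.forall).trans (forall_congr' fun b => ?_)
    exact and_congr (ih _) (and_congr (ih _) (ih _))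

theorem centrallyNilpotent_of_centralQuotient (h : CentrallyNilpotent (CentralQuotient B)) :
    CentrallyNilpotent B := by
  obtain ⟨n, hn⟩ := h
  refine ⟨n + 1, Set.eq_univ_of_forall fun x => ?_⟩
  rw [← CentralQuotient.mk_mem_zeta_iff, hn]
  trivial

theorem lam_mem_center (a : B) {z : B} (hz : z ∈ AddSubgroup.center B) :
    lam a z ∈ AddSubgroup.center B := by
  rw [AddSubgroup.mem_center_iff] at hz ⊢
  intro c
  have hc : c = lam a (lam a⁻¹ c) := by rw [← lam_mul, mul_inv_cancel, lam_one]
  rw [hc, ← lam_add, ← lam_add, hz]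

/-- The action of `(B,·)` on `Z(B,+)` through `λ`. -/
@[reducible]
def centerAction : MulAction B (AddSubgroup.center B) where
  smul a z := ⟨lam a z, lam_mem_center a z.2⟩
  one_smul _ := Subtype.ext (lam_one _)
  mul_smul a b _ := Subtype.ext (lam_mul a b _)

end Basic

theorem exists_isCentral_ne_zero {B : Type*} [SkewBrace B] [Finite B] [Nontrivial B]
    {p n : ℕ} (hp : p.Prime) (hcard : Nat.card B = p ^ n)
    (hsq : ∀ b : B, b * b = b + b) : ∃ z : B, IsCentral z ∧ z ≠ 0 := by
  have := Fact.mk hp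
  have hadd : IsPGroup p (Multiplicative B) := IsPGroup.of_card (n := n) hcard
  have hmul : IsPGroup p B := IsPGroup.of_card hcard
  have : Nontrivial (Subgroup.center (Multiplicative B)) := hadd.center_nontrivial
  have hcenter : p ∣ Nat.card (AddSubgroup.center B) := by
    obtain ⟨k, hk, hk'⟩ := (hadd.to_subgroup (Subgroup.center _)).nontrivial_iff_card.mp this
    have : Nat.card (AddSubgroup.center B) =
        Nat.card (Subgroup.center (Multiplicative B)) :=
      Nat.card_congr (Multiplicative.ofAdd.subtypeEquiv fun z => by
        rw [AddSubgroup.mem_center_iff, Subgroup.mem_center_iff]; rfl)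
    rw [this, hk']
    exact dvd_pow_self p hk.ne'
  let := centerAction (B := B)
  obtain ⟨z, hz, hne⟩ := hmul.exists_fixed_point_of_prime_dvd_card_of_fixed_point
    (AddSubgroup.center B) hcenter (a := 0) fun a => Subtype.ext (lam_zero a)
  have hfix (a : B) : a * (z : B) = a + z := by
    rw [mul_eq_add_lam]
    exact congrArg (a + ·) (congrArg Subtype.val (hz a))
  have hcomm (a : B) : a + (z : B) = z + a := AddSubgroup.mem_center_iff.mp z.2 a
  refine ⟨z, fun b => ?_, fun h => hne (Subtype.ext h.symm)⟩
  have hzb := mul_eq_add_symm hsq (hfix b)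
  exact ⟨hzb, (hcomm b).symm, by rw [hzb, hfix, hcomm]⟩

theorem centrallyNilpotent_of_mul_self {B : Type*} [SkewBrace B] [Finite B]
    {p n : ℕ} (hp : p.Prime) (hcard : Nat.card B = p ^ n)
    (hsq : ∀ b : B, b * b = b + b) : CentrallyNilpotent B := by
  induction hm : Nat.card B using Nat.strong_induction_on generalizing B n with
  | _ m ih =>
    subst hm
    rcases subsingleton_or_nontrivial B with _ | _
    · exact ⟨0, Set.eq_univ_of_forall fun x => Subsingleton.elim x 0⟩
    obtain ⟨z, hz, hne⟩ := exists_isCentral_ne_zero hp hcard hsq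
    have hfin : Finite (CentralQuotient B) := Finite.of_surjective _ CentralQuotient.mk_surjective
    have hlt : Nat.card (CentralQuotient B) < Nat.card B := by
      refine lt_of_le_of_ne (Nat.card_le_card_of_surjective _ CentralQuotient.mk_surjective)
        fun h => hne ?_
      have hinj := (Nat.bijective_iff_surjective_and_card CentralQuotient.mk).mpr
        ⟨CentralQuotient.mk_surjective (B := B), h.symm⟩
      exact hinj.1 (CentralQuotient.mk_eq_zero_iff.mpr hz)
    have hdvd : Nat.card (CentralQuotient B) ∣ p ^ n := by
      rw [← hcard]
      exact Subgroup.card_dvd_of_surjective (centralCon B).mk' CentralQuotient.mk_surjective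
    obtain ⟨k, -, hk⟩ := (Nat.dvd_prime_pow hp).mp hdvd
    refine centrallyNilpotent_of_centralQuotient (ih _ hlt hk ?_ rfl)
    exact CentralQuotient.mk_surjective.forall.mpr fun b => congrArg CentralQuotient.mk (hsq b)

end SkewBrace

/-- A finite skew brace of prime power order in which `b ∗ b = 0` for all `b`
is centrally nilpotent. -/
theorem statement3 (B : Type*) [SkewBrace B] [Fintype B]
    (p n : ℕ) (hp : p.Prime) (hcard : Fintype.card B = p ^ n)
    (hstar : ∀ b : B, sstar b b = 0) :
    CentrallyNilpotent B := by
  refine SkewBrace.centrallyNilpotent_of_mul_self hp (Nat.card_eq_fintype_card.trans hcard)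
    fun b => ?_
  exact neg_add_eq_iff_eq_add.mp (sub_eq_zero.mp (hstar b))
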